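/- Let A be a polygonal curve with vertices p_1,…,p_n ∈ ℝ^d and uniform parameterization A : [0,L] → ℝ^d, and let τ be a segment from z to z′ with z ≠ z′, uniformly parameterized as τ : [0, ‖z′ − z‖] → ℝ^d, such that the nearest point of p_1 on τ is z and the nearest point of p_n on τ is z′. For t ∈ [0,L], let f(t) be the parameter of the unique nearest point to A(t) on τ, and let F(t) = max_{τ' ∈ [0,t]} f(τ'). Let W = sup_{t ∈ [0,L]} ‖A(t) − τ(F(t))‖. Then d_F(A, τ) ≤ W ≤ 3 · d_F(A, τ). -/

import Mathlib

open Set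

/-- A weakly monotone continuous surjective reparameterization of `[0,1]`. -/
def Reparam (φ : ℝ → ℝ) : Prop :=
  ContinuousOn φ (Set.Icc 0 1) ∧ MonotoneOn φ (Set.Icc 0 1) ∧
    φ '' Set.Icc 0 1 = Set.Icc 0 1

/-- The (continuous, monotone) Fréchet distance between two curves parameterized
over `[0,1]`. -/
noncomputable def frechetDist {V : Type*} [NormedAddCommGroup V] [NormedSpace ℝ V]
    (f g : ℝ → V) : ℝ :=
  sInf { r | ∃ φ ψ, Reparam φ ∧ Reparam ψ ∧
    r = sSup ((fun t => ‖f (φ t) - g (ψ t)‖) '' Set.Icc (0 : ℝ) 1) }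

/-- The vertices of a polygonal curve, extended to an `ℕ`-indexed family by clamping. -/
def pext {d n : ℕ} (p : Fin (n + 1) → EuclideanSpace ℝ (Fin d)) :
    ℕ → EuclideanSpace ℝ (Fin d) :=
  fun j => p ⟨min j n, Nat.lt_succ_of_le (min_le_right _ _)⟩

/-- `cum p i` is the arc length of the polygonal curve `p` up to its `i`-th vertex;
`cum p n` is its total length. -/
noncomputable def cum {d n : ℕ} (p : Fin (n + 1) → EuclideanSpace ℝ (Fin d)) (i : ℕ) : ℝ :=
  ∑ j ∈ Finset.range (min i n), dist (pext p j) (pext p (j + 1))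

/-- `A : [0, cum p n] → ℝ^d` is the uniform (arc-length) parameterization of the polygonal
curve with vertices `p 0, …, p n`. -/
def IsArcParam {d n : ℕ} (p : Fin (n + 1) → EuclideanSpace ℝ (Fin d))
    (A : ℝ → EuclideanSpace ℝ (Fin d)) : Prop :=
  ∀ i < n, ∀ x ∈ Set.Icc (cum p i) (cum p (i + 1)),
    A x = pext p i +
      ((x - cum p i) / dist (pext p i) (pext p (i + 1))) • (pext p (i + 1) - pext p i)

/-- The uniform parameterization `[0, dist a b] → ℝ^d` of the segment from `a` to `b`. -/
noncomputable def segParam {d : ℕ} (a b : EuclideanSpace ℝ (Fin d)) :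
    ℝ → EuclideanSpace ℝ (Fin d) :=
  fun x => a + (x / dist a b) • (b - a)

/-- The running maximum `F(t) = max_{τ ∈ [0,t]} f(τ)`. -/
noncomputable def runMax (f : ℝ → ℝ) (t : ℝ) : ℝ := sSup (f '' Set.Icc 0 t)

lemma dist_segParam {d : ℕ} {z z' : EuclideanSpace ℝ (Fin d)} (hzz : z ≠ z') (x y : ℝ) :
    dist (segParam z z' x) (segParam z z' y) = |x - y| := by
  have hD : 0 < dist z z' := dist_pos.2 hzz
  rw [dist_eq_norm]
  have : segParam z z' x - segParam z z' y = ((x - y) / dist z z') • (z' - z) := by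
    simp only [segParam]
    rw [sub_div]
    module
  rw [this, norm_smul, ← dist_eq_norm, dist_comm z' z, Real.norm_eq_abs, abs_div,
    abs_of_pos hD, div_mul_cancel₀ _ hD.ne']

lemma segParam_zero {d : ℕ} (z z' : EuclideanSpace ℝ (Fin d)) : segParam z z' 0 = z := by
  simp [segParam]

lemma segParam_dist {d : ℕ} {z z' : EuclideanSpace ℝ (Fin d)} (hzz : z ≠ z') :
    segParam z z' (dist z z') = z' := by
  simp [segParam, div_self (dist_pos.2 hzz).ne']

lemma continuous_segParam {d : ℕ} (z z' : EuclideanSpace ℝ (Fin d)) :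
    Continuous (segParam z z') := by
  unfold segParam
  fun_prop

lemma dist_segParam_sq {d : ℕ} {z z' : EuclideanSpace ℝ (Fin d)} (hzz : z ≠ z')
    (a : EuclideanSpace ℝ (Fin d)) (y : ℝ) :
    dist a (segParam z z' y) ^ 2 =
      ‖a - z‖ ^ 2 - 2 * y * (inner ℝ (a - z) (z' - z) / dist z z') + y ^ 2 := by
  have hD : 0 < dist z z' := dist_pos.2 hzz
  have hn : ‖z' - z‖ = dist z z' := by rw [← dist_eq_norm, dist_comm]
  have : a - segParam z z' y = (a - z) - (y / dist z z') • (z' - z) := by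
    simp only [segParam]
    abel
  rw [dist_eq_norm, this, norm_sub_sq_real, inner_smul_right, norm_smul, hn, Real.norm_eq_abs,
    mul_pow, sq_abs]
  field_simp

/-- The parameter of a nearest point on a segment is the clamped orthogonal projection. -/
lemma nearest_eq_clamp {d : ℕ} {z z' : EuclideanSpace ℝ (Fin d)} (hzz : z ≠ z')
    {a : EuclideanSpace ℝ (Fin d)} {x : ℝ} (hx : x ∈ Icc 0 (dist z z'))
    (hmin : ∀ y ∈ Icc (0 : ℝ) (dist z z'),
      dist a (segParam z z' x) ≤ dist a (segParam z z' y)) :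
    x = max 0 (min (dist z z') (inner ℝ (a - z) (z' - z) / dist z z')) := by
  have key : ∀ y ∈ Icc (0 : ℝ) (dist z z'),
      x ^ 2 - 2 * x * (inner ℝ (a - z) (z' - z) / dist z z') ≤
        y ^ 2 - 2 * y * (inner ℝ (a - z) (z' - z) / dist z z') := by
    intro y hy
    have h := pow_le_pow_left₀ dist_nonneg (hmin y hy) 2
    rw [dist_segParam_sq hzz, dist_segParam_sq hzz] at h
    linarith
  have hD : 0 < dist z z' := dist_pos.2 hzz
  generalize inner ℝ (a - z) (z' - z) / dist z z' = g at key ⊢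
  obtain ⟨h0, h1⟩ := hx
  rcases le_total g 0 with hg | hg
  · rw [min_eq_right (by linarith), max_eq_left hg]
    nlinarith [key 0 ⟨le_rfl, hD.le⟩]
  rcases le_total g (dist z z') with hg' | hg'
  · rw [min_eq_right hg', max_eq_right hg]
    have := key g ⟨hg, hg'⟩
    have h2 : (x - g) ^ 2 ≤ 0 := by nlinarith
    linarith [pow_eq_zero_iff (two_ne_zero) |>.1 (le_antisymm h2 (sq_nonneg _))]
  · rw [min_eq_left hg', max_eq_right hD.le]
    nlinarith [key _ ⟨hD.le, le_rfl⟩]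

section PolygonalCurve

variable {d n : ℕ} {p : Fin (n + 1) → EuclideanSpace ℝ (Fin d)}
  {A : ℝ → EuclideanSpace ℝ (Fin d)}

lemma cum_zero : cum p 0 = 0 := by simp [cum]

lemma cum_succ {i : ℕ} (hi : i < n) :
    cum p (i + 1) = cum p i + dist (pext p i) (pext p (i + 1)) := by
  rw [cum, cum, min_eq_left (Nat.succ_le_of_lt hi), min_eq_left hi.le, Finset.sum_range_succ]

lemma cum_nonneg (i : ℕ) : 0 ≤ cum p i :=
  Finset.sum_nonneg fun _ _ => dist_nonneg

lemma IsArcParam.continuousOn (hA : IsArcParam p A) : ContinuousOn A (Icc 0 (cum p n)) := by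
  suffices h : ∀ i ≤ n, ContinuousOn A (Icc 0 (cum p i)) from h n le_rfl
  intro i
  induction i with
  | zero => simp [cum_zero]
  | succ i ih =>
    intro hi
    have hle : cum p i ≤ cum p (i + 1) := by
      rw [cum_succ hi]
      exact le_add_of_nonneg_right dist_nonneg
    rw [← Icc_union_Icc_eq_Icc (cum_nonneg i) hle]
    refine (ih (Nat.le_of_succ_le hi)).union_of_isClosed ?_ isClosed_Icc isClosed_Icc
    refine ContinuousOn.congr (Continuous.continuousOn ?_) (hA i hi)
    fun_prop

lemma IsArcParam.apply_zero (hA : IsArcParam p A) (hn : 0 < n) : A 0 = p 0 := by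
  have h := hA 0 hn 0 ⟨cum_zero.le, cum_nonneg _⟩
  simpa [cum_zero, pext] using h

lemma IsArcParam.apply_length (hA : IsArcParam p A) (hn : 0 < n) :
    A (cum p n) = p (Fin.last n) := by
  obtain ⟨m, rfl⟩ : ∃ m, n = m + 1 := ⟨n - 1, by omega⟩
  have hc := cum_succ (p := p) (Nat.lt_succ_self m)
  have h := hA m (Nat.lt_succ_self m) (cum p (m + 1))
    ⟨hc ▸ le_add_of_nonneg_right dist_nonneg, le_rfl⟩
  have hlast : pext p (m + 1) = p (Fin.last (m + 1)) := by
    simp [pext, Fin.last]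
  rw [h, hc, add_sub_cancel_left, ← hlast]
  rcases eq_or_ne (pext p m) (pext p (m + 1)) with he | he
  · simp [he]
  · rw [div_self (dist_pos.2 he).ne', one_smul, add_sub_cancel]

end PolygonalCurve

section RunningMaximum

variable {f : ℝ → ℝ} {L : ℝ}

lemma bddAbove_image_Icc (hf : ContinuousOn f (Icc 0 L)) {t : ℝ} (ht : t ≤ L) :
    BddAbove (f '' Icc 0 t) :=
  (isCompact_Icc.image_of_continuousOn (hf.mono (Icc_subset_Icc_right ht))).bddAbove

lemma le_runMax (hf : ContinuousOn f (Icc 0 L)) {s t : ℝ} (hs : s ∈ Icc 0 t) (ht : t ≤ L) :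
    f s ≤ runMax f t :=
  le_csSup (bddAbove_image_Icc hf ht) (mem_image_of_mem f hs)

lemma exists_runMax_eq (hf : ContinuousOn f (Icc 0 L)) {t : ℝ} (ht : t ∈ Icc 0 L) :
    ∃ s ∈ Icc 0 t, f s = runMax f t :=
  (isCompact_Icc.image_of_continuousOn (hf.mono (Icc_subset_Icc_right ht.2))).sSup_mem
    ((nonempty_Icc.2 ht.1).image f)

lemma monotoneOn_runMax (hf : ContinuousOn f (Icc 0 L)) : MonotoneOn (runMax f) (Icc 0 L) :=
  fun _ hs _ ht hst => csSup_le_csSup (bddAbove_image_Icc hf ht.2)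
    ((nonempty_Icc.2 hs.1).image f) (image_mono (Icc_subset_Icc_right hst))

lemma continuousOn_runMax (hL : 0 ≤ L) (hf : ContinuousOn f (Icc 0 L)) :
    ContinuousOn (runMax f) (Icc 0 L) := by
  let g : ℝ → ℝ := IccExtend hL ((Icc 0 L).domRestrict f)
  have hg : Continuous g := (continuousOn_iff_continuous_domRestrict.1 hf).Icc_extend'
  have hgf : ∀ x ∈ Icc 0 L, g x = f x := fun x hx => IccExtend_of_mem hL _ hx
  have hc : Continuous fun t : ℝ => sSup ((fun s : ℝ => g (t * s)) '' Icc 0 1) :=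
    isCompact_Icc.continuous_sSup (f := fun t s : ℝ => g (t * s))
      (hg.comp (continuous_fst.mul continuous_snd))
  refine hc.continuousOn.congr fun t ht => ?_
  have himg : (fun s : ℝ => t * s) '' Icc 0 1 = Icc 0 t := by
    simpa using image_mul_left_Icc ht.1 (zero_le_one' ℝ)
  rw [runMax]
  congr 1
  rw [← himg, image_image]
  refine image_congr fun s hs => (hgf _ ⟨mul_nonneg ht.1 hs.1, ?_⟩).symm
  exact (mul_le_of_le_one_right ht.1 hs.2).trans ht.2

/-- The rescaled running maximum of a function climbing from `0` to its maximum `D` is a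
reparameterization. -/
lemma reparam_runMax {D : ℝ} (hL : 0 ≤ L) (hD : 0 < D) (hf : ContinuousOn f (Icc 0 L))
    (hmem : ∀ t ∈ Icc 0 L, f t ∈ Icc 0 D) (h0 : f 0 = 0) (hfL : f L = D) :
    Reparam fun u => runMax f (u * L) / D := by
  have hmaps : MapsTo (fun u : ℝ => u * L) (Icc 0 1) (Icc 0 L) := fun u hu =>
    ⟨mul_nonneg hu.1 hL, mul_le_of_le_one_left hL hu.2⟩
  have hcont : ContinuousOn (fun u => runMax f (u * L) / D) (Icc 0 1) :=
    ((continuousOn_runMax hL hf).comp (by fun_prop) hmaps).div_const D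
  have hmono : MonotoneOn (fun u => runMax f (u * L) / D) (Icc 0 1) := fun u hu v hv huv =>
    div_le_div_of_nonneg_right (monotoneOn_runMax hf (hmaps hu) (hmaps hv)
      (mul_le_mul_of_nonneg_right huv hL)) hD.le
  have hzero : runMax f 0 = 0 := by simp [runMax, h0]
  have hone : runMax f L = D := by
    obtain ⟨s, hs, hsL⟩ := exists_runMax_eq hf (right_mem_Icc.2 hL)
    exact le_antisymm (hsL ▸ (hmem s hs).2) (hfL ▸ le_runMax hf (right_mem_Icc.2 hL) le_rfl)
  refine ⟨hcont, hmono, Subset.antisymm ?_ ?_⟩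
  · rintro _ ⟨u, hu, rfl⟩
    obtain ⟨s, hs, hsu⟩ := exists_runMax_eq hf (hmaps hu)
    obtain ⟨h1, h2⟩ := hmem s ⟨hs.1, hs.2.trans (hmaps hu).2⟩
    rw [hsu] at h1 h2
    exact ⟨div_nonneg h1 hD.le, (div_le_one hD).2 h2⟩
  · have h := intermediate_value_Icc zero_le_one hcont
    simpa [hzero, hone, hD.ne'] using h

end RunningMaximum

lemma reparam_id : Reparam fun u => u :=
  ⟨continuousOn_id, monotoneOn_id, image_id _⟩

lemma Reparam.mapsTo {φ : ℝ → ℝ} (h : Reparam φ) : MapsTo φ (Icc 0 1) (Icc 0 1) :=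
  fun _ hu => h.2.2 ▸ mem_image_of_mem φ hu

lemma frechetDist_le {V : Type*} [NormedAddCommGroup V] [NormedSpace ℝ V] (f g : ℝ → V)
    {φ ψ : ℝ → ℝ} (hφ : Reparam φ) (hψ : Reparam ψ) :
    frechetDist f g ≤ sSup ((fun t => ‖f (φ t) - g (ψ t)‖) '' Icc (0 : ℝ) 1) := by
  refine csInf_le ⟨0, ?_⟩ ⟨φ, ψ, hφ, hψ, rfl⟩
  rintro _ ⟨_, _, _, _, rfl⟩
  refine Real.sSup_nonneg ?_
  rintro _ ⟨_, _, rfl⟩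
  exact norm_nonneg _

lemma le_frechetDist {V : Type*} [NormedAddCommGroup V] [NormedSpace ℝ V] {f g : ℝ → V} {c : ℝ}
    (h : ∀ φ ψ, Reparam φ → Reparam ψ →
      c ≤ sSup ((fun t => ‖f (φ t) - g (ψ t)‖) '' Icc (0 : ℝ) 1)) :
    c ≤ frechetDist f g := by
  refine le_csInf ⟨_, _, _, reparam_id, reparam_id, rfl⟩ ?_
  rintro _ ⟨φ, ψ, hφ, hψ, rfl⟩
  exact h φ ψ hφ hψ

/-- A matching within `r` places every monotonized nearest point within `3 * r`. -/
lemma dist_segParam_runMax_le {d : ℕ} {z z' : EuclideanSpace ℝ (Fin d)} (hzz : z ≠ z')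
    {A : ℝ → EuclideanSpace ℝ (Fin d)} {f : ℝ → ℝ} {L r : ℝ} (hL : 0 < L)
    (hfc : ContinuousOn f (Icc 0 L))
    (hf : ∀ t ∈ Icc 0 L, ∀ y ∈ Icc (0 : ℝ) (dist z z'),
      dist (A t) (segParam z z' (f t)) ≤ dist (A t) (segParam z z' y))
    {φ ψ : ℝ → ℝ} (hφ : Reparam φ) (hψ : Reparam ψ)
    (hr : ∀ u ∈ Icc (0 : ℝ) 1,
      dist (A (φ u * L)) (segParam z z' (ψ u * dist z z')) ≤ r)
    {t : ℝ} (ht : t ∈ Icc 0 L) :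
    dist (A t) (segParam z z' (runMax f t)) ≤ 3 * r := by
  have hD : 0 < dist z z' := dist_pos.2 hzz
  have hpre : ∀ x ∈ Icc 0 L, ∃ a ∈ Icc (0 : ℝ) 1, φ a * L = x := by
    intro x hx
    have : x / L ∈ φ '' Icc 0 1 := by
      rw [hφ.2.2]
      exact ⟨div_nonneg hx.1 hL.le, (div_le_one hL).2 hx.2⟩
    obtain ⟨a, ha, hax⟩ := this
    exact ⟨a, ha, by rw [hax, div_mul_cancel₀ _ hL.ne']⟩
  have hnear : ∀ a ∈ Icc (0 : ℝ) 1, |f (φ a * L) - ψ a * dist z z'| ≤ 2 * r := by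
    intro a ha
    have hx : φ a * L ∈ Icc 0 L :=
      ⟨mul_nonneg (hφ.mapsTo ha).1 hL.le, mul_le_of_le_one_left hL.le (hφ.mapsTo ha).2⟩
    have hy : ψ a * dist z z' ∈ Icc 0 (dist z z') :=
      ⟨mul_nonneg (hψ.mapsTo ha).1 hD.le, mul_le_of_le_one_left hD.le (hψ.mapsTo ha).2⟩
    rw [← dist_segParam hzz]
    linarith [dist_triangle_left (segParam z z' (f (φ a * L)))
      (segParam z z' (ψ a * dist z z')) (A (φ a * L)), hf _ hx _ hy, hr a ha]
  obtain ⟨s, hs, hst⟩ := exists_runMax_eq hfc ht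
  have hft : f t ≤ runMax f t := le_runMax hfc ⟨ht.1, le_rfl⟩ ht.2
  obtain ⟨a, ha, hat⟩ := hpre t ht
  obtain ⟨b, hb, hba, hbs⟩ : ∃ b ∈ Icc (0 : ℝ) 1, b ≤ a ∧ φ b * L = s := by
    rcases hs.2.eq_or_lt with rfl | hlt
    · exact ⟨a, ha, le_rfl, hat⟩
    · obtain ⟨b, hb, hbs⟩ := hpre s ⟨hs.1, hs.2.trans ht.2⟩
      refine ⟨b, hb, le_of_not_gt fun hab => ?_, hbs⟩
      have := mul_le_mul_of_nonneg_right (hφ.2.1 ha hb hab.le) hL.le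
      linarith
  have hψba := mul_le_mul_of_nonneg_right (hψ.2.1 hb ha hba) hD.le
  have hna := abs_le.1 (hnear a ha)
  have hnb := abs_le.1 (hnear b hb)
  rw [hat] at hna
  rw [hbs, hst] at hnb
  have hda := hr a ha
  rw [hat] at hda
  have hclose : |ψ a * dist z z' - runMax f t| ≤ 2 * r :=
    abs_le.2 ⟨by linarith, by linarith⟩
  rw [← dist_segParam hzz] at hclose
  linarith [dist_triangle (A t) (segParam z z' (ψ a * dist z z')) (segParam z z' (runMax f t))]

/-- The width `W` of the monotonized nearest-point projection morphing of
a polygonal curve `A` onto a segment `τ` (whose endpoints are the nearest points of the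
endpoints of `A`) is a `3`-approximation of the Fréchet distance:
`d_F(A, τ) ≤ W ≤ 3 d_F(A, τ)`. -/
theorem projection_morphing_approximates (d n : ℕ)
    (p : Fin (n + 1) → EuclideanSpace ℝ (Fin d))
    (z z' : EuclideanSpace ℝ (Fin d)) (hzz : z ≠ z')
    (A : ℝ → EuclideanSpace ℝ (Fin d)) (hA : IsArcParam p A)
    (hz : ∀ y ∈ Set.Icc (0 : ℝ) (dist z z'), dist (p 0) z ≤ dist (p 0) (segParam z z' y))
    (hz' : ∀ y ∈ Set.Icc (0 : ℝ) (dist z z'),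
      dist (p (Fin.last n)) z' ≤ dist (p (Fin.last n)) (segParam z z' y))
    (f : ℝ → ℝ)
    (hf : ∀ t ∈ Set.Icc (0 : ℝ) (cum p n),
      f t ∈ Set.Icc (0 : ℝ) (dist z z') ∧
      ∀ y ∈ Set.Icc (0 : ℝ) (dist z z'),
        dist (A t) (segParam z z' (f t)) ≤ dist (A t) (segParam z z' y)) :
    frechetDist (fun u => A (u * cum p n)) (fun u => segParam z z' (u * dist z z')) ≤
      sSup ((fun t => dist (A t) (segParam z z' (runMax f t))) ''
        Set.Icc (0 : ℝ) (cum p n)) ∧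
    sSup ((fun t => dist (A t) (segParam z z' (runMax f t))) ''
        Set.Icc (0 : ℝ) (cum p n)) ≤
      3 * frechetDist (fun u => A (u * cum p n)) (fun u => segParam z z' (u * dist z z')) := by
  have hD : 0 < dist z z' := dist_pos.2 hzz
  have hD0 : (0 : ℝ) ∈ Icc 0 (dist z z') := ⟨le_rfl, hD.le⟩
  have hDD : dist z z' ∈ Icc 0 (dist z z') := ⟨hD.le, le_rfl⟩
  have hp0 := nearest_eq_clamp hzz (a := p 0) hD0 (by rwa [segParam_zero])
  have hpn := nearest_eq_clamp hzz (a := p (Fin.last n)) hDD (by rwa [segParam_dist hzz])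
  have hfp := fun t ht => nearest_eq_clamp hzz (hf t ht).1 (hf t ht).2
  have hn : 0 < n := by
    rcases Nat.eq_zero_or_pos n with rfl | h
    · exact absurd (hp0.trans hpn.symm) hD.ne
    · exact h
  have hLnn : 0 ≤ cum p n := cum_nonneg n
  have hf0 : f 0 = 0 := by
    rw [hfp 0 ⟨le_rfl, hLnn⟩, hA.apply_zero hn, ← hp0]
  have hfL : f (cum p n) = dist z z' := by
    rw [hfp _ ⟨hLnn, le_rfl⟩, hA.apply_length hn, ← hpn]
  have hL : 0 < cum p n := hLnn.lt_of_ne fun h => by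
    rw [← h, hf0] at hfL
    exact hD.ne hfL
  have hAc := hA.continuousOn
  have hfc : ContinuousOn f (Icc 0 (cum p n)) := by
    refine ContinuousOn.congr ?_ hfp
    fun_prop
  constructor
  · refine (frechetDist_le _ _ reparam_id
      (reparam_runMax hLnn hD hfc (fun t ht => (hf t ht).1) hf0 hfL)).trans_eq ?_
    have himg : (fun u : ℝ => u * cum p n) '' Icc 0 1 = Icc 0 (cum p n) := by
      simpa using image_mul_right_Icc (zero_le_one' ℝ) hLnn
    rw [← himg, image_image]
    simp only [div_mul_cancel₀ _ hD.ne', dist_eq_norm (A _)]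
  · suffices h : sSup ((fun t => dist (A t) (segParam z z' (runMax f t))) ''
        Icc (0 : ℝ) (cum p n)) / 3 ≤
        frechetDist (fun u => A (u * cum p n)) (fun u => segParam z z' (u * dist z z')) by
      linarith
    refine le_frechetDist fun φ ψ hφ hψ => ?_
    rw [div_le_iff₀' three_pos]
    refine csSup_le ((nonempty_Icc.2 hLnn).image _) ?_
    rintro _ ⟨t, ht, rfl⟩
    refine dist_segParam_runMax_le hzz hL hfc (fun t ht => (hf t ht).2) hφ hψ (fun u hu => ?_) ht
    rw [dist_eq_norm]
    refine le_csSup (isCompact_Icc.image_of_continuousOn ?_).bddAbove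
      (mem_image_of_mem (fun t => ‖A (φ t * cum p n) - segParam z z' (ψ t * dist z z')‖) hu)
    have hAφ : ContinuousOn (fun t => A (φ t * cum p n)) (Icc 0 1) :=
      hAc.comp (hφ.1.mul_const _) fun u hu =>
        ⟨mul_nonneg (hφ.mapsTo hu).1 hLnn, mul_le_of_le_one_left hLnn (hφ.mapsTo hu).2⟩
    exact (hAφ.sub ((continuous_segParam z z').comp_continuousOn (hψ.1.mul_const _))).norm
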